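/- Let f : A → B and m : C → D be surjective quandle homomorphisms with Eq(f) ⊆ ≈_A and Eq(m) ∩ ≈_C = Δ_C, and let g : A → C and h : B → D be quandle homomorphisms with h ∘ f = m ∘ g. Then there exists a unique quandle homomorphism t : B → C such that t ∘ f = g and m ∘ t = h. (Orthogonality of the classes 𝓔 and 𝓜 of the reflective factorisation system for surjective homomorphisms of quandles.) -/

import Mathlib

/- Conventions: we use Mathlib's `Quandle`, in which the translation by `b` is
`Rack.act' b : a ↦ b ◃ a` (the mirror of the paper's right-action convention
`ρ_b : a ↦ a ◃ b`).  Accordingly, a *trivial* quandle is one with `x ◃ y = y`. -/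

open Quandles

/-- The subgroup `Inn(A)` of inner automorphisms of a quandle `A`: the subgroup of the
permutation group of `A` generated by the translations. -/
def Inn (A : Type*) [Quandle A] : Subgroup (Equiv.Perm A) :=
  Subgroup.closure (Set.range fun b : A => (Rack.act' b : Equiv.Perm A))

/-- A quandle homomorphism: a map preserving `◃` (and hence `◃⁻¹`). -/
def IsQndHom {A B : Type*} [Quandle A] [Quandle B] (f : A → B) : Prop :=
  ∀ a a' : A, f (a ◃ a') = f a ◃ f a'

/-- A congruence on a quandle: an equivalence relation compatible with `◃` and `◃⁻¹`. -/
def IsQndCongr {A : Type*} [Quandle A] (R : A → A → Prop) : Prop :=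
  Equivalence R ∧
    (∀ a b a' b' : A, R a b → R a' b' → R (a ◃ a') (b ◃ b')) ∧
    (∀ a b a' b' : A, R a b → R a' b' → R (a ◃⁻¹ a') (b ◃⁻¹ b'))

/-- The component relation (connectedness) setoid of a quandle: `a ≈ b` iff some inner
automorphism sends `a` to `b`.  Its quotient is `π₀(A)`. -/
def compSetoid (A : Type*) [Quandle A] : Setoid A where
  r a b := ∃ φ ∈ Inn A, φ a = b
  iseqv := by
    constructor
    · exact fun a => ⟨1, one_mem _, rfl⟩
    · rintro a b ⟨φ, hφ, rfl⟩
      exact ⟨φ⁻¹, inv_mem hφ, by simp⟩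
    · rintro a b c ⟨φ, hφ, rfl⟩ ⟨ψ, hψ, rfl⟩
      exact ⟨ψ * φ, mul_mem hψ hφ, by simp⟩

/-- Inner automorphisms lift along any homomorphism. -/
theorem inn_lift {A C : Type*} [Quandle A] [Quandle C] (g : A → C) (hg : IsQndHom g)
    (φ : Equiv.Perm A) (hφ : φ ∈ Inn A) : ∃ ψ ∈ Inn C, ∀ a, ψ (g a) = g (φ a) := by
  unfold Inn at hφ
  induction hφ using Subgroup.closure_induction with
  | mem x hx =>
    obtain ⟨b, rfl⟩ := hx
    exact ⟨Rack.act' (g b), Subgroup.subset_closure ⟨g b, rfl⟩, fun a => (hg b a).symm⟩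
  | one => exact ⟨1, one_mem _, fun a => rfl⟩
  | mul x y _ _ hx hy =>
    obtain ⟨p, hp, hp'⟩ := hx
    obtain ⟨q, hq, hq'⟩ := hy
    exact ⟨p * q, mul_mem hp hq, fun a => by simp [hp', hq']⟩
  | inv x _ hx =>
    obtain ⟨p, hp, hp'⟩ := hx
    refine ⟨p⁻¹, inv_mem hp, fun a => ?_⟩
    rw [Equiv.Perm.inv_eq_iff_eq, hp']
    simp

/-- Orthogonality of the classes `𝓔` and `𝓜`: given surjective homomorphisms `f ∈ 𝓔` and
`m ∈ 𝓜` and homomorphisms `g`, `h` with `h ∘ f = m ∘ g`, there is a unique homomorphism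
`t` with `t ∘ f = g` and `m ∘ t = h`. -/
theorem stmt11 {A B C D : Type*} [Quandle A] [Quandle B] [Quandle C] [Quandle D]
    (f : A → B) (m : C → D) (g : A → C) (h : B → D)
    (hfs : Function.Surjective f) (hms : Function.Surjective m)
    (hfh : IsQndHom f) (hmh : IsQndHom m) (hgh : IsQndHom g) (hhh : IsQndHom h)
    (hE : ∀ a a' : A, f a = f a' → ∃ φ ∈ Inn A, φ a = a')
    (hM : ∀ c c' : C, m c = m c' → (∃ ψ ∈ Inn C, ψ c = c') → c = c')
    (hcomm : ∀ a : A, h (f a) = m (g a)) :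
    ∃! t : B → C, IsQndHom t ∧ (∀ a : A, t (f a) = g a) ∧ (∀ b : B, m (t b) = h b) := by
  have key : ∀ a a' : A, f a = f a' → g a = g a' := by
    intro a a' haa
    apply hM
    · rw [← hcomm, ← hcomm, haa]
    · obtain ⟨φ, hφ, rfl⟩ := hE a a' haa
      obtain ⟨ψ, hψ, H⟩ := inn_lift g hgh φ hφ
      exact ⟨ψ, hψ, H a⟩
  choose s hs using hfs
  have ht : ∀ a, g (s (f a)) = g a := fun a => key _ _ (hs (f a))
  refine ⟨fun b => g (s b), ⟨?_, ht, ?_⟩, ?_⟩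
  · intro b b'
    change g (s (b ◃ b')) = g (s b) ◃ g (s b')
    rw [← hgh]
    apply key
    rw [hfh, hs, hs, hs]
  · intro b
    change m (g (s b)) = h b
    rw [← hcomm, hs]
  · rintro t ⟨_, h1, _⟩
    funext b
    change t b = g (s b)
    rw [← h1, hs]
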